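/- Let 𝔫 be a finite-dimensional Lie algebra over ℚ. The Lie algebra ℂ ⊗_ℚ 𝔫 admits a very special grading if and only if there exists a Lie algebra automorphism f of 𝔫 such that no eigenvalue of f is an algebraic integer. -/

import Mathlib

open TensorProduct

/-- A (ℤ-)grading of a Lie algebra `𝔪` over `K`: a direct sum decomposition
`𝔪 = ⊕_{k ∈ ℤ} 𝔪ₖ` with `⁅𝔪ᵢ, 𝔪ⱼ⁆ ⊆ 𝔪ᵢ₊ⱼ`. -/
def IsLieGrading (K 𝔪 : Type*) [CommRing K] [LieRing 𝔪] [LieAlgebra K 𝔪]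
    (p : ℤ → Submodule K 𝔪) : Prop :=
  DirectSum.IsInternal p ∧
    ∀ (i j : ℤ), ∀ x ∈ p i, ∀ y ∈ p j, ⁅x, y⁆ ∈ p (i + j)

/-- A Lie algebra admits a *special* grading if it has a grading with `𝔪₀ ∩ 𝔷 = 0`,
where `𝔷` is the center. -/
def HasSpecialGrading (K 𝔪 : Type*) [CommRing K] [LieRing 𝔪] [LieAlgebra K 𝔪] : Prop :=
  ∃ p : ℤ → Submodule K 𝔪, IsLieGrading K 𝔪 p ∧
    p 0 ⊓ (LieAlgebra.center K 𝔪).toSubmodule = ⊥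

/-- A Lie algebra admits a *very special* grading if it has a grading with `𝔪₀ = 0`. -/
def HasVerySpecialGrading (K 𝔪 : Type*) [CommRing K] [LieRing 𝔪] [LieAlgebra K 𝔪] : Prop :=
  ∃ p : ℤ → Submodule K 𝔪, IsLieGrading K 𝔪 p ∧ p 0 = ⊥

/-- A Lie algebra admits a *non-negative special* grading if it has a grading with
`𝔪ₖ = 0` for `k < 0` and `𝔪₀ ∩ 𝔷 = 0`. -/
def HasNonnegSpecialGrading (K 𝔪 : Type*) [CommRing K] [LieRing 𝔪] [LieAlgebra K 𝔪] : Prop :=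
  ∃ p : ℤ → Submodule K 𝔪, IsLieGrading K 𝔪 p ∧ (∀ k < 0, p k = ⊥) ∧
    p 0 ⊓ (LieAlgebra.center K 𝔪).toSubmodule = ⊥

/-- A Lie algebra admits a *positive* grading if it has a grading with
`𝔪ₖ = 0` for `k ≤ 0`. -/
def HasPositiveGrading (K 𝔪 : Type*) [CommRing K] [LieRing 𝔪] [LieAlgebra K 𝔪] : Prop :=
  ∃ p : ℤ → Submodule K 𝔪, IsLieGrading K 𝔪 p ∧ ∀ k ≤ 0, p k = ⊥

open Module Polynomial in
/-- Interpolation: a polynomial congruent to the constant `c a` modulo `(X - a) ^ N` for each `a`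
in a finite set. -/
theorem exists_polynomial_pow_dvd_sub_C {K : Type*} [Field K] (E : Finset K) (c : K → K) (N : ℕ) :
    ∃ P : K[X], ∀ a ∈ E, (X - C a) ^ N ∣ P - C (c a) := by
  have hI : Pairwise (Function.onFun IsCoprime
      fun a : E ↦ Ideal.span {(X - C (a : K)) ^ N}) := by
    intro a b hab
    rw [Function.onFun, Ideal.isCoprime_span_singleton_iff]
    exact (isCoprime_X_sub_C_of_isUnit_sub
      (sub_ne_zero.mpr fun h ↦ hab (Subtype.ext h)).isUnit).pow
  obtain ⟨P, hP⟩ := Ideal.exists_forall_sub_mem_ideal hI fun a ↦ C (c a)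
  exact ⟨P, fun a ha ↦ Ideal.mem_span_singleton.mp (hP ⟨a, ha⟩)⟩

open Module Polynomial in
theorem aeval_apply_of_mem_maxGenEigenspace {K V : Type*} [Field K] [AddCommGroup V] [Module K V]
    [FiniteDimensional K V] {F : End K V} {a c : K} {P : K[X]}
    (hP : (X - C a) ^ finrank K V ∣ P - C c) {x : V} (hx : x ∈ F.maxGenEigenspace a) :
    aeval F P x = c • x := by
  obtain ⟨Q, hQ⟩ := hP
  rw [End.maxGenEigenspace_eq_genEigenspace_finrank, End.mem_genEigenspace_nat,
    LinearMap.mem_ker] at hx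
  have h : aeval F (P - C c) x = 0 := by
    rw [hQ, mul_comm, map_mul, Module.End.mul_apply, map_pow, map_sub, aeval_X, aeval_C,
      Algebra.algebraMap_eq_smul_one, hx, map_zero]
  rw [map_sub, aeval_C, LinearMap.sub_apply, Module.algebraMap_end_apply, sub_eq_zero] at h
  exact h

open Module in
theorem eq_zero_of_mem_maxGenEigenspace {K V : Type*} [Field K] [AddCommGroup V] [Module K V]
    {F : End K V} {a : K} (ha : ¬ F.HasEigenvalue a) {x : V} (hx : x ∈ F.maxGenEigenspace a) :
    x = 0 := by
  by_contra hne
  refine ha (End.HasUnifEigenvalue.lt (k := ⊤) one_pos fun h ↦ hne ?_)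
  exact (Submodule.mem_bot K).mp (h ▸ hx)

open Module in
/-- If `S` acts as the scalar `c a` on the generalized eigenspaces of `F`, which span, then
each eigenvalue of `S` is one of these scalars. -/
theorem exists_eq_of_hasEigenvalue {K V : Type*} [Field K] [AddCommGroup V] [Module K V]
    {F S : End K V} {c : K → K} (htop : ⨆ a, F.maxGenEigenspace a = ⊤)
    (hS : ∀ a, ∀ x ∈ F.maxGenEigenspace a, S x = c a • x) {μ : K} (hμ : S.HasEigenvalue μ) :
    ∃ a, F.HasEigenvalue a ∧ μ = c a := by
  by_contra! h
  have hle : (⊤ : Submodule K V) ≤ ⨆ ν, ⨆ (_ : ν ≠ μ), S.eigenspace ν := by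
    rw [← htop]
    refine iSup_le fun a ↦ ?_
    by_cases ha : F.HasEigenvalue a
    · exact le_iSup₂_of_le (c a) (h a ha).symm fun x hx ↦ End.mem_eigenspace_iff.mpr (hS a x hx)
    · intro x hx
      simp [eq_zero_of_mem_maxGenEigenspace ha hx]
  have := S.eigenspaces_iSupIndep μ
  rw [top_le_iff.mp hle, disjoint_top] at this
  exact hμ this

/-- A twisted Leibniz rule for linear maps, iterated. -/
theorem pow_apply_lie_eq_zero {K L : Type*} [CommRing K] [LieRing L] [LieAlgebra K L]
    {T N M : Module.End K L} {a b c : K}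
    (h : ∀ x y : L, T ⁅x, y⁆ = a • ⁅N x, M y⁆ + b • ⁅N x, y⁆ + c • ⁅x, M y⁆) :
    ∀ (n k l : ℕ), k + l ≤ n → ∀ x y : L, (N ^ k) x = 0 → (M ^ l) y = 0 → (T ^ n) ⁅x, y⁆ = 0 := by
  intro n
  induction n with
  | zero =>
    intro k l hkl x y hx hy
    obtain ⟨rfl, rfl⟩ : k = 0 ∧ l = 0 := by omega
    simp_all
  | succ n ih =>
    intro k l hkl x y hx hy
    rcases k with _ | k
    · simp_all
    rcases l with _ | l
    · simp_all
    rw [pow_succ, Module.End.mul_apply] at hx hy ⊢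
    rw [h, map_add, map_add, map_smul, map_smul, map_smul,
      ih k l (by omega) _ _ hx hy,
      ih k (l + 1) (by omega) (N x) y hx (by rwa [pow_succ, Module.End.mul_apply]),
      ih (k + 1) l (by omega) x (M y) (by rwa [pow_succ, Module.End.mul_apply]) hy]
    simp

theorem lie_mem_maxGenEigenspace_add {K L : Type*} [CommRing K] [LieRing L] [LieAlgebra K L]
    {D : Module.End K L} (hD : ∀ x y : L, D ⁅x, y⁆ = ⁅D x, y⁆ + ⁅x, D y⁆) {a b : K} {x y : L}
    (hx : x ∈ D.maxGenEigenspace a) (hy : y ∈ D.maxGenEigenspace b) :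
    ⁅x, y⁆ ∈ D.maxGenEigenspace (a + b) := by
  rw [Module.End.mem_maxGenEigenspace] at hx hy ⊢
  obtain ⟨k, hk⟩ := hx
  obtain ⟨l, hl⟩ := hy
  refine ⟨k + l, pow_apply_lie_eq_zero (a := 0) (b := 1) (c := 1) ?_ _ k l le_rfl x y hk hl⟩
  intro x y
  simp [hD, sub_lie, lie_sub, add_smul]
  abel

theorem lie_mem_maxGenEigenspace_mul {K L : Type*} [CommRing K] [LieRing L] [LieAlgebra K L]
    {F : Module.End K L} (hF : ∀ x y : L, F ⁅x, y⁆ = ⁅F x, F y⁆) {a b : K} {x y : L}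
    (hx : x ∈ F.maxGenEigenspace a) (hy : y ∈ F.maxGenEigenspace b) :
    ⁅x, y⁆ ∈ F.maxGenEigenspace (a * b) := by
  rw [Module.End.mem_maxGenEigenspace] at hx hy ⊢
  obtain ⟨k, hk⟩ := hx
  obtain ⟨l, hl⟩ := hy
  refine ⟨k + l, pow_apply_lie_eq_zero (a := 1) (b := b) (c := a) ?_ _ k l le_rfl x y hk hl⟩
  intro x y
  simp [hF, sub_lie, lie_sub, smul_sub, smul_smul]

/-- Two bilinear expressions agree as soon as they agree on a spanning family of subspaces. -/
theorem eq_of_forall_mem_iSup_eq_top {ι K V W : Type*} [CommRing K] [AddCommGroup V] [Module K V]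
    [AddCommGroup W] [Module K W] {p : ι → Submodule K V} (hp : ⨆ i, p i = ⊤)
    {B B' : V →ₗ[K] V →ₗ[K] W} (h : ∀ i j, ∀ x ∈ p i, ∀ y ∈ p j, B x y = B' x y) : B = B' := by
  ext x y
  induction (hp ▸ Submodule.mem_top : x ∈ ⨆ i, p i) using Submodule.iSup_induction' with
  | zero => simp
  | add x x' _ _ hx hx' => simp [hx, hx']
  | mem i x hx =>
    induction (hp ▸ Submodule.mem_top : y ∈ ⨆ i, p i) using Submodule.iSup_induction' with
    | zero => simp
    | add y y' _ _ hy hy' => simp [hy, hy']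
    | mem j y hy => exact h i j x hx y hy

open Module in
theorem exists_int_dual_forall_apply_ne_zero {ι M : Type*} [Finite ι] [AddCommGroup M]
    [Module.Free ℤ M] [Module.Finite ℤ M] (v : ι → M) (hv : ∀ i, v i ≠ 0) :
    ∃ f : M →ₗ[ℤ] ℤ, ∀ i, f (v i) ≠ 0 := by
  classical
  let b := Module.Free.chooseBasis ℤ M
  let w : ι → Free.ChooseBasisIndex ℤ M → ℚ := fun i j ↦ (b.repr (v i) j : ℚ)
  have hw : ∀ i, w i ≠ 0 := by
    intro i h
    apply hv i
    apply b.repr.injective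
    ext j
    simpa [w] using congrFun h j
  obtain ⟨f, hf⟩ := Module.exists_dual_forall_apply_ne_zero (K := ℚ) w hw
  obtain ⟨⟨N, hN⟩, hNf⟩ := IsLocalization.exist_integer_multiples_of_finite (nonZeroDivisors ℤ)
    fun j ↦ f (Pi.single j 1)
  choose n hn using hNf
  refine ⟨b.constr ℤ n, fun i h ↦ hf i ?_⟩
  have h1 : ((b.constr ℤ n (v i) : ℤ) : ℚ) = N * f (w i) := by
    rw [Basis.constr_apply_fintype, LinearMap.pi_apply_eq_sum_univ f (w i), Finset.mul_sum]
    push_cast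
    refine Finset.sum_congr rfl fun j _ ↦ ?_
    have := hn j
    simp only [algebraMap_int_eq, eq_intCast, zsmul_eq_mul] at this
    simp [w, this, Basis.equivFun_apply]
    have hs : (fun k ↦ if j = k then (1 : ℚ) else 0) = Pi.single j 1 := by
      ext k
      simp [Pi.single_apply, eq_comm]
    rw [hs]
    ring
  rw [h, Int.cast_zero, eq_comm, mul_eq_zero] at h1
  exact h1.resolve_left (by exact_mod_cast nonZeroDivisors.ne_zero hN)

/-- Finitely many units of infinite order admit a ℤ-valued degree which is additive on them and
vanishes on none of them. -/
theorem exists_int_valued_log {G : Type*} [CommGroup G] (s : Finset G)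
    (hs : ∀ g ∈ s, ¬ IsOfFinOrder g) :
    ∃ l : G → ℤ, (∀ g ∈ s, ∀ h ∈ s, l (g * h) = l g + l h) ∧ ∀ g ∈ s, l g ≠ 0 := by
  classical
  let H := Subgroup.closure (s : Set G)
  let A := Additive H
  have : AddGroup.FG A := by
    rw [AddGroup.fg_iff_mul_fg]
    infer_instance
  have : Module.Finite ℤ A := Module.Finite.iff_addGroup_fg.mpr this
  have hH : ∀ g ∈ s, g ∈ H := fun g hg ↦ Subgroup.subset_closure hg
  let q := (Submodule.torsion ℤ A).mkQ
  obtain ⟨f, hf⟩ := exists_int_dual_forall_apply_ne_zero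
    (fun g : s ↦ q (Additive.ofMul ⟨g, hH g g.2⟩)) <| by
      rintro ⟨g, hg⟩ h
      rw [Submodule.mkQ_apply, Submodule.Quotient.mk_eq_zero, Submodule.mem_torsion_iff] at h
      obtain ⟨⟨n, hn⟩, h⟩ := h
      refine hs g hg (isOfFinOrder_iff_zpow_eq_one.mpr ⟨n, nonZeroDivisors.ne_zero hn, ?_⟩)
      exact congrArg (fun a : A ↦ (a.toMul : G)) h
  refine ⟨fun g ↦ if h : g ∈ H then f (q (Additive.ofMul ⟨g, h⟩)) else 0, ?_, ?_⟩
  · intro g hg h hh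
    beta_reduce
    rw [dif_pos (hH g hg), dif_pos (hH h hh), dif_pos (mul_mem (hH g hg) (hH h hh)), ← map_add,
      ← map_add]
    rfl
  · intro g hg
    beta_reduce
    rw [dif_pos (hH g hg)]
    exact hf ⟨g, hg⟩

open NumberField Polynomial in
theorem exists_int_one_sub_mul_not_isUnit {K : Type*} [Field K] [NumberField K] [IsGalois ℚ K]
    {b : 𝓞 K} (hb : b ≠ 0) : ∃ k : ℤ, 1 - k * b ≠ 0 ∧ ¬ IsUnit (1 - k * b) := by
  by_contra! h
  let Q : K[X] := ∏ σ : Gal(K/ℚ), (1 - C (σ b) * X)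
  have hσ : ∀ σ : Gal(K/ℚ), (1 - C (σ (b : K)) * X : K[X]).natDegree = 1 := by
    intro σ
    have : (1 - C (σ (b : K)) * X : K[X]) = C (-σ (b : K)) * X + C 1 := by
      simp; ring
    rw [this, natDegree_linear (by simpa using hb)]
  have hne : ∀ σ : Gal(K/ℚ), (1 - C (σ (b : K)) * X : K[X]) ≠ 0 := fun σ h0 ↦ by
    simpa [h0] using hσ σ
  have hQ0 : Q ≠ 0 := Finset.prod_ne_zero_iff.mpr fun σ _ ↦ hne σ
  have hdeg : 0 < Q.natDegree := by
    rw [natDegree_prod _ _ fun σ _ ↦ hne σ, Finset.sum_congr rfl fun σ _ ↦ hσ σ]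
    simp [Fintype.card_pos]
  have heval : ∀ k : ℤ, Q.eval (k : K) = ((Algebra.norm ℚ ((1 - k * b : 𝓞 K) : K) : ℚ) : K) := by
    intro k
    have := Algebra.norm_eq_prod_automorphisms ℚ ((1 - k * b : 𝓞 K) : K)
    rw [eq_ratCast] at this
    rw [this, eval_prod]
    refine Finset.prod_congr rfl fun σ _ ↦ ?_
    simp only [eval_sub, eval_one, eval_mul, eval_C, eval_X, map_sub, map_one, map_mul, map_intCast]
    ring
  have hzero : Q * (Q ^ 2 - 1) = 0 := by
    apply Polynomial.eq_zero_of_infinite_isRoot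
    refine (Set.infinite_range_of_injective (Int.cast_injective (α := K))).mono ?_
    rintro _ ⟨k, rfl⟩
    by_cases hk : 1 - k * b = 0
    · rw [Set.mem_ofPred_eq, IsRoot.def, eval_mul, heval, hk]
      simp
    · have hu := NumberField.isUnit_iff_norm.mp (h k hk)
      rw [RingOfIntegers.coe_norm] at hu
      have h2 : (Algebra.norm ℚ ((1 - k * b : 𝓞 K) : K)) ^ 2 = 1 := by
        rw [← sq_abs, hu, one_pow]
      have h3 : (((Algebra.norm ℚ ((1 - k * b : 𝓞 K) : K)) : ℚ) : K) ^ 2 = 1 := by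
        exact_mod_cast h2
      rw [Set.mem_ofPred_eq, IsRoot.def, eval_mul, eval_sub, eval_pow, eval_one, heval, h3,
        sub_self, mul_zero]
  have h2 : Q ^ 2 = 1 := sub_eq_zero.mp ((mul_eq_zero.mp hzero).resolve_left hQ0)
  have := congrArg natDegree h2
  rw [natDegree_pow, natDegree_one] at this
  omega

open NumberField in
theorem exists_int_sub_mem_isMaximal {K : Type*} [Field K] [NumberField K] [IsGalois ℚ K]
    {θ m : 𝓞 K} (hθ : θ ≠ 0) (hm : m ≠ 0) :
    ∃ (n : ℤ) (P : Ideal (𝓞 K)), P.IsMaximal ∧ m ∣ n ∧ θ - n ≠ 0 ∧ θ - n ∈ P ∧ m ∉ P := by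
  have hθm := mul_ne_zero hθ hm
  obtain ⟨M, b, hM0, hM⟩ : ∃ (M : ℤ) (b : 𝓞 K), M ≠ 0 ∧ (M : 𝓞 K) = θ * m * b := by
    obtain ⟨b, hb⟩ := RingOfIntegers.dvd_norm ℚ (θ * m)
    obtain ⟨M, hM⟩ := Rat.ringOfIntegersEquiv.symm.surjective (RingOfIntegers.norm ℚ (θ * m))
    rw [← hM] at hb
    have hb' : (M : 𝓞 K) = θ * m * b := by simpa using hb
    refine ⟨M, b, ?_, hb'⟩
    rintro rfl
    rw [Int.cast_zero] at hb'
    have h0 : RingOfIntegers.norm ℚ (θ * m) = 0 := by rw [← hM, map_zero]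
    have h1 := RingOfIntegers.coe_norm ℚ (θ * m)
    rw [h0] at h1
    exact hθm (RingOfIntegers.coe_eq_zero_iff.mp (Algebra.norm_eq_zero_iff.mp
      (h1.symm.trans (map_zero (algebraMap (𝓞 ℚ) ℚ)))))
  have hb : b ≠ 0 := by
    rintro rfl
    simp [hM0] at hM
  obtain ⟨k, hk0, hk⟩ := exists_int_one_sub_mul_not_isUnit (mul_ne_zero hm hb)
  obtain ⟨P, hP, hPk⟩ := exists_max_ideal_of_mem_nonunits hk
  have hfac : θ - ((k * M : ℤ) : 𝓞 K) = θ * (1 - k * (m * b)) := by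
    push_cast
    rw [hM]
    ring
  refine ⟨k * M, P, hP, ?_, ?_, ?_, ?_⟩
  · push_cast
    rw [hM]
    exact ⟨k * (θ * b), by ring⟩
  · rw [hfac]
    exact mul_ne_zero hθ hk0
  · rw [hfac]
    exact P.mul_mem_left _ hPk
  · intro hmP
    refine hP.ne_top ((Ideal.eq_top_iff_one P).mpr ?_)
    have := P.add_mem hPk (P.mul_mem_left (k * b) hmP)
    convert this using 1
    ring

open NumberField in
theorem exists_integer_forall_galois_apply_ne (K : Type*) [Field K] [NumberField K] :
    ∃ θ : 𝓞 K, θ ≠ 0 ∧ ∀ σ : Gal(K/ℚ), σ ≠ 1 → σ • θ ≠ θ := by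
  obtain ⟨α, hα⟩ := Field.exists_primitive_element ℚ K
  have hfix : ∀ σ : Gal(K/ℚ), σ α = α → σ = 1 := by
    intro σ h
    ext x
    have hx : x ∈ IntermediateField.adjoin ℚ {α} := hα ▸ IntermediateField.mem_top
    induction hx using IntermediateField.adjoin_induction with
    | mem x hx => rw [Set.mem_singleton_iff.mp hx, h, AlgEquiv.one_apply]
    | algebraMap q => simp
    | add x y _ _ hx hy => rw [map_add, map_add, hx, hy]
    | inv x _ hx => rw [map_inv₀, map_inv₀, hx]
    | mul x y _ _ hx hy => rw [map_mul, map_mul, hx, hy]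
  by_cases h0 : α = 0
  · refine ⟨1, one_ne_zero, fun σ hσ ↦ absurd (hfix σ ?_) hσ⟩
    simp [h0]
  obtain ⟨y, hy0, hy⟩ := exists_integral_multiples ℤ ℚ {α}
  refine ⟨⟨y • α, hy α (by simp)⟩, fun h ↦ ?_, fun σ hσ h ↦ hσ (hfix σ ?_)⟩
  · have : y • α = 0 := congrArg (algebraMap (𝓞 K) K) h
    simp_all
  · have : σ (y • α) = y • α := congrArg (algebraMap (𝓞 K) K) h
    rw [map_zsmul] at this
    exact smul_right_injective K hy0 this

open NumberField IsDedekindDomain in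
theorem exists_galois_separated_element (K : Type*) [Field K] [NumberField K] [IsGalois ℚ K] :
    ∃ x : K, x ≠ 0 ∧
      (∃ v : HeightOneSpectrum (𝓞 K), v.valuation K x < 1 ∧
        ∀ σ : Gal(K/ℚ), σ ≠ 1 → v.valuation K (σ x) = 1) ∧
      ∃ v : HeightOneSpectrum (𝓞 K), 1 < v.valuation K x ∧
        ∀ σ : Gal(K/ℚ), σ ≠ 1 → v.valuation K (σ x) = 1 := by
  classical
  obtain ⟨θ, hθ, hσθ⟩ := exists_integer_forall_galois_apply_ne K
  set δ : 𝓞 K := ∏ σ ∈ Finset.univ.erase (1 : Gal(K/ℚ)), (σ • θ - θ) with hδ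
  set ν : 𝓞 K := ∏ σ : Gal(K/ℚ), σ • θ with hν
  have hδ0 : δ ≠ 0 := Finset.prod_ne_zero_iff.mpr fun σ hσ ↦
    sub_ne_zero.mpr (hσθ σ (Finset.ne_of_mem_erase hσ))
  have hν0 : ν ≠ 0 := Finset.prod_ne_zero_iff.mpr fun σ _ ↦ (smul_ne_zero_iff_ne σ).mpr hθ
  have hδP : ∀ {P : Ideal (𝓞 K)}, δ ∉ P → ∀ σ : Gal(K/ℚ), σ ≠ 1 → σ • θ - θ ∉ P :=
    fun {P} hP σ hσ hmem ↦
      hP (P.mem_of_dvd (Finset.dvd_prod_of_mem _ (by simpa using hσ)) hmem)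
  have hsmul : ∀ (σ : Gal(K/ℚ)) (n : ℤ), σ • (θ - n) = σ • θ - n := by
    intro σ n
    rw [smul_sub]
    congr 1
    exact map_intCast (MulSemiringAction.toRingHom Gal(K/ℚ) (𝓞 K) σ) n
  have hsep : ∀ {P : Ideal (𝓞 K)} {n : ℤ}, δ ∉ P → θ - n ∈ P → ∀ σ : Gal(K/ℚ), σ ≠ 1 →
      σ • (θ - n) ∉ P := by
    intro P n hP hn σ hσ hmem
    apply hδP hP σ hσ
    have := P.sub_mem hmem hn
    rwa [hsmul, sub_sub_sub_cancel_right] at this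
  obtain ⟨n, P, hP, -, hn0, hnP, hmP⟩ := exists_int_sub_mem_isMaximal hθ (mul_ne_zero hδ0 hν0)
  set η : 𝓞 K := ∏ σ : Gal(K/ℚ), σ • (θ - n) with hη
  have hη0 : η ≠ 0 := Finset.prod_ne_zero_iff.mpr fun σ _ ↦ (smul_ne_zero_iff_ne σ).mpr hn0
  obtain ⟨n', P', hP', hdvd, hn0', hnP', hmP'⟩ :=
    exists_int_sub_mem_isMaximal hθ (mul_ne_zero hδ0 hη0)
  have hδnP : δ ∉ P := fun h ↦ hmP (P.mul_mem_right _ h)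
  have hνnP : ν ∉ P := fun h ↦ hmP (P.mul_mem_left _ h)
  have hδnP' : δ ∉ P' := fun h ↦ hmP' (P'.mul_mem_right _ h)
  have hηnP' : η ∉ P' := fun h ↦ hmP' (P'.mul_mem_left _ h)
  have hcross' : ∀ σ : Gal(K/ℚ), σ • (θ - n) ∉ P' := fun σ hmem ↦
    hηnP' (P'.mem_of_dvd (Finset.dvd_prod_of_mem _ (Finset.mem_univ σ)) hmem)
  have hn'P : (n' : 𝓞 K) ∈ P := by
    refine P.mem_of_dvd hdvd (P.mul_mem_left _ (P.mem_of_dvd ?_ hnP))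
    simpa using Finset.dvd_prod_of_mem (fun σ : Gal(K/ℚ) ↦ σ • (θ - n)) (Finset.mem_univ 1)
  have hcross : ∀ σ : Gal(K/ℚ), σ • (θ - n') ∉ P := by
    intro σ hmem
    apply hνnP
    refine P.mem_of_dvd (Finset.dvd_prod_of_mem _ (Finset.mem_univ σ)) ?_
    have := P.add_mem hmem hn'P
    rwa [hsmul, sub_add_cancel] at this
  let v : HeightOneSpectrum (𝓞 K) :=
    ⟨P, hP.isPrime, Ring.ne_bot_of_isMaximal_of_not_isField hP (RingOfIntegers.not_isField K)⟩
  let v' : HeightOneSpectrum (𝓞 K) :=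
    ⟨P', hP'.isPrime, Ring.ne_bot_of_isMaximal_of_not_isField hP' (RingOfIntegers.not_isField K)⟩
  have hx : ∀ σ : Gal(K/ℚ), σ (algebraMap (𝓞 K) K (θ - n) / algebraMap (𝓞 K) K (θ - n')) =
      algebraMap (𝓞 K) K (σ • (θ - n)) / algebraMap (𝓞 K) K (σ • (θ - n')) :=
    fun σ ↦ map_div₀ σ _ _
  refine ⟨algebraMap (𝓞 K) K (θ - n) / algebraMap (𝓞 K) K (θ - n'), ?_, ⟨v, ?_, ?_⟩, v', ?_, ?_⟩
  · exact div_ne_zero (RingOfIntegers.coe_ne_zero_iff.mpr hn0)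
      (RingOfIntegers.coe_ne_zero_iff.mpr hn0')
  · have h1 := hcross 1
    rw [one_smul] at h1
    rw [map_div₀, v.valuation_eq_one_iff_notMem.mpr h1, div_one]
    exact (v.valuation_lt_one_iff_mem _).mpr hnP
  · intro σ hσ
    rw [hx, map_div₀, v.valuation_eq_one_iff_notMem.mpr (hcross σ),
      v.valuation_eq_one_iff_notMem.mpr (hsep hδnP hnP σ hσ), div_one]
  · have h1 := hcross' 1
    rw [one_smul] at h1
    rw [map_div₀, v'.valuation_eq_one_iff_notMem.mpr h1, one_div]
    refine (one_lt_inv₀ ?_).mpr ((v'.valuation_lt_one_iff_mem _).mpr hnP')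
    exact (Valuation.pos_iff _).mpr (RingOfIntegers.coe_ne_zero_iff.mpr hn0')
  · intro σ hσ
    rw [hx, map_div₀, v'.valuation_eq_one_iff_notMem.mpr (hcross' σ),
      v'.valuation_eq_one_iff_notMem.mpr (hsep hδnP' hnP' σ hσ), div_one]

open NumberField IsDedekindDomain in
theorem exists_equivariant_hom_not_isIntegral {K : Type*} [Field K] [NumberField K] [IsGalois ℚ K]
    (f : 𝓞 K →ₗ[ℤ] ℤ) :
    ∃ g : 𝓞 K → K, (∀ a b, g (a + b) = g a * g b) ∧
      (∀ (σ : Gal(K/ℚ)) (a), g (σ • a) = σ (g a)) ∧ ∀ a, f a ≠ 0 → ¬ IsIntegral ℤ (g a) := by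
  classical
  obtain ⟨x, hx, ⟨v, hv, hvσ⟩, v', hv', hvσ'⟩ := exists_galois_separated_element K
  have hσx : ∀ σ : Gal(K/ℚ), σ x ≠ 0 := fun σ ↦ by simpa using hx
  have hval : ∀ w : HeightOneSpectrum (𝓞 K),
      (∀ σ : Gal(K/ℚ), σ ≠ 1 → w.valuation K (σ x) = 1) → ∀ a,
      w.valuation K (∏ σ : Gal(K/ℚ), σ x ^ f (σ⁻¹ • a)) = w.valuation K x ^ f a := by
    intro w hw a
    rw [map_prod, Finset.prod_eq_single 1]
    · simp
    · intro σ _ hσ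
      rw [map_zpow₀, hw σ hσ, one_zpow]
    · simp
  refine ⟨fun a ↦ ∏ σ : Gal(K/ℚ), σ x ^ f (σ⁻¹ • a), ?_, ?_, ?_⟩
  · intro a b
    rw [← Finset.prod_mul_distrib]
    refine Finset.prod_congr rfl fun σ _ ↦ ?_
    rw [smul_add, map_add, zpow_add₀ (hσx σ)]
  · intro σ a
    rw [map_prod]
    refine (Fintype.prod_equiv (Equiv.mulLeft σ) _ _ fun τ ↦ ?_).symm
    rw [map_zpow₀, Equiv.coe_mulLeft, mul_inv_rev, mul_smul, inv_smul_smul]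
    rfl
  · intro a ha hint
    have hle : ∀ w : HeightOneSpectrum (𝓞 K),
        w.valuation K (∏ σ : Gal(K/ℚ), σ x ^ f (σ⁻¹ • a)) ≤ 1 :=
      fun w ↦ w.valuation_le_one ⟨_, hint⟩
    rcases lt_or_gt_of_ne ha with h | h
    · have := hle v
      rw [hval v hvσ] at this
      exact this.not_gt (one_lt_zpow_of_neg₀ ((Valuation.pos_iff _).mpr hx) hv h)
    · have := hle v'
      rw [hval v' hvσ'] at this
      exact this.not_gt (one_lt_zpow₀ hv' h)

open NumberField in
/-- On a finite set of nonzero elements of a Galois number field there is a Galois equivariant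
function turning sums into products, none of whose values is an algebraic integer. -/
theorem exists_equivariant_exponential {K : Type*} [Field K] [NumberField K] [IsGalois ℚ K]
    (E : Finset K) (hE : ∀ a ∈ E, a ≠ 0) :
    ∃ c : K → K, (∀ a ∈ E, ∀ b ∈ E, c (a + b) = c a * c b) ∧
      (∀ (σ : Gal(K/ℚ)), ∀ a ∈ E, c (σ a) = σ (c a)) ∧ ∀ a ∈ E, ¬ IsIntegral ℤ (c a) := by
  classical
  obtain ⟨y, hy0, hy⟩ := exists_integral_multiples ℤ ℚ E
  obtain ⟨f, hf⟩ := exists_int_dual_forall_apply_ne_zero (M := 𝓞 K)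
    (fun a : E ↦ (⟨y • (a : K), hy a a.2⟩ : 𝓞 K)) <| by
      rintro ⟨a, ha⟩ h
      have : y • a = 0 := congrArg (algebraMap (𝓞 K) K) h
      exact (smul_ne_zero hy0 (hE a ha)) this
  obtain ⟨g, hadd, hgal, hint⟩ := exists_equivariant_hom_not_isIntegral f
  refine ⟨fun a ↦ if h : IsIntegral ℤ (y • a) then g ⟨y • a, h⟩ else 1, ?_, ?_, ?_⟩
  · intro a ha b hb
    have hab : IsIntegral ℤ (y • (a + b)) := by
      rw [smul_add]
      exact (hy a ha).add (hy b hb)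
    beta_reduce
    rw [dif_pos (hy a ha), dif_pos (hy b hb), dif_pos hab]
    exact (congrArg g (RingOfIntegers.ext (smul_add y a b))).trans (hadd _ _)
  · intro σ a ha
    have hσ : IsIntegral ℤ (y • σ a) := by
      rw [← map_zsmul]
      exact (hy a ha).map (σ : K →+* K).toIntAlgHom
    beta_reduce
    rw [dif_pos (hy a ha), dif_pos hσ]
    exact (congrArg g (RingOfIntegers.ext (map_zsmul σ y a).symm)).trans (hgal _ _)
  · intro a ha
    beta_reduce
    rw [dif_pos (hy a ha)]
    exact hint _ (hf ⟨a, ha⟩)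

open Module in
theorem hasVerySpecialGrading_of_forall_not_isOfFinOrder {K 𝔪 : Type*} [Field K] [CharZero K]
    [IsAlgClosed K] [LieRing 𝔪] [LieAlgebra K 𝔪] [FiniteDimensional K 𝔪] {F : End K 𝔪}
    (hF : ∀ x y : 𝔪, F ⁅x, y⁆ = ⁅F x, F y⁆) (h0 : ¬ F.HasEigenvalue 0)
    (h : ∀ a, F.HasEigenvalue a → ¬ IsOfFinOrder a) : HasVerySpecialGrading K 𝔪 := by
  classical
  let E : Finset K := F.charpoly.roots.toFinset
  have hE : ∀ a, a ∈ E ↔ F.HasEigenvalue a := by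
    intro a
    rw [End.hasEigenvalue_iff_isRoot_charpoly, Multiset.mem_toFinset,
      Polynomial.mem_roots F.charpoly_monic.ne_zero]
  obtain ⟨l, hl, hl0⟩ :=
    exists_int_valued_log (E.preimage Units.val Units.val_injective.injOn) <| by
    intro u hu
    rw [Finset.mem_preimage, hE] at hu
    rw [← Units.isOfFinOrder_val]
    exact h _ hu
  let c : K → ℤ := fun a ↦ if ha : a ≠ 0 then l (Units.mk0 a ha) else 0
  have hne : ∀ {a}, F.HasEigenvalue a → a ≠ 0 := fun ha h ↦ h0 (h ▸ ha)
  have hmem : ∀ {a} (ha : F.HasEigenvalue a),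
      Units.mk0 a (hne ha) ∈ E.preimage Units.val Units.val_injective.injOn := fun ha ↦ by
    rw [Finset.mem_preimage, hE]
    exact ha
  have hc : ∀ a b, F.HasEigenvalue a → F.HasEigenvalue b → c (a * b) = c a + c b := by
    intro a b ha hb
    simp only [c]
    rw [dif_pos (hne ha), dif_pos (hne hb), dif_pos (mul_ne_zero (hne ha) (hne hb)),
      ← hl _ (hmem ha) _ (hmem hb), Units.mk0_mul]
  have hc0 : ∀ a, F.HasEigenvalue a → c a ≠ 0 := by
    intro a ha
    simp only [c]
    rw [dif_pos (hne ha)]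
    exact hl0 _ (hmem ha)
  obtain ⟨P, hP⟩ := exists_polynomial_pow_dvd_sub_C E (fun a ↦ (c a : K)) (finrank K 𝔪)
  set S : End K 𝔪 := Polynomial.aeval F P
  have htop := End.iSup_maxGenEigenspace_eq_top F
  have hS : ∀ a, ∀ x ∈ F.maxGenEigenspace a, S x = (c a : K) • x := by
    intro a x hx
    by_cases ha : F.HasEigenvalue a
    · exact aeval_apply_of_mem_maxGenEigenspace (hP a ((hE a).mpr ha)) hx
    · rw [eq_zero_of_mem_maxGenEigenspace ha hx, map_zero, smul_zero]
  have hder : ∀ x y : 𝔪, S ⁅x, y⁆ = ⁅S x, y⁆ + ⁅x, S y⁆ := by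
    let B : 𝔪 →ₗ[K] 𝔪 →ₗ[K] 𝔪 := (LieAlgebra.ad K 𝔪 : 𝔪 →ₗ[K] End K 𝔪)
    have := eq_of_forall_mem_iSup_eq_top htop (B := B.compr₂ S) (B' := B.comp S + B.compl₂ S) <| by
      intro a b x hx y hy
      change S ⁅x, y⁆ = ⁅S x, y⁆ + ⁅x, S y⁆
      by_cases ha : F.HasEigenvalue a
      swap
      · simp [eq_zero_of_mem_maxGenEigenspace ha hx]
      by_cases hb : F.HasEigenvalue b
      swap
      · simp [eq_zero_of_mem_maxGenEigenspace hb hy]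
      rw [hS a x hx, hS b y hy, hS _ _ (lie_mem_maxGenEigenspace_mul hF hx hy), hc a b ha hb,
        smul_lie, lie_smul, Int.cast_add, add_smul]
    exact fun x y ↦ LinearMap.congr_fun₂ this x y
  refine ⟨fun k ↦ S.eigenspace k, ⟨?_, ?_⟩, ?_⟩
  · refine DirectSum.isInternal_submodule_of_iSupIndep_of_iSup_eq_top
      (S.eigenspaces_iSupIndep.comp Int.cast_injective) ?_
    rw [eq_top_iff, ← htop]
    exact iSup_le fun a ↦ le_iSup_of_le (c a) fun x hx ↦ End.mem_eigenspace_iff.mpr (hS a x hx)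
  · intro i j x hx y hy
    rw [End.mem_eigenspace_iff] at hx hy ⊢
    rw [hder, hx, hy, smul_lie, lie_smul, Int.cast_add, add_smul]
  · by_contra hbot
    obtain ⟨a, ha, h⟩ := exists_eq_of_hasEigenvalue htop hS (μ := ((0 : ℤ) : K)) hbot
    exact hc0 a ha (Int.cast_injective h.symm)

theorem LinearMap.baseChange_lie_of_forall_lie {R A L : Type*} [CommRing R] [CommRing A]
    [Algebra R A] [LieRing L] [LieAlgebra R L] {f : Module.End R L}
    (hf : ∀ x y : L, f ⁅x, y⁆ = ⁅f x, f y⁆) (x y : A ⊗[R] L) :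
    f.baseChange A ⁅x, y⁆ = ⁅f.baseChange A x, f.baseChange A y⁆ := by
  induction x with
  | zero => simp
  | add x x' hx hx' => simp [hx, hx']
  | tmul a x =>
    induction y with
    | zero => simp
    | add y y' hy hy' => simp [hy, hy']
    | tmul b y => simp [hf]

theorem LinearMap.baseChange_lie_of_forall_leibniz {R A L : Type*} [CommRing R] [CommRing A]
    [Algebra R A] [LieRing L] [LieAlgebra R L] {d : Module.End R L}
    (hd : ∀ x y : L, d ⁅x, y⁆ = ⁅d x, y⁆ + ⁅x, d y⁆) (x y : A ⊗[R] L) :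
    d.baseChange A ⁅x, y⁆ = ⁅d.baseChange A x, y⁆ + ⁅x, d.baseChange A y⁆ := by
  induction x with
  | zero => simp
  | add x x' hx hx' => simp [hx, hx']; abel
  | tmul a x =>
    induction y with
    | zero => simp
    | add y y' hy hy' => simp [hy, hy']; abel
    | tmul b y => simp [hd, TensorProduct.tmul_add]

theorem hasVerySpecialGrading_of_aut {L 𝔫 : Type*} [Field L] [CharZero L] [IsAlgClosed L]
    [Algebra.IsAlgebraic ℚ L] [LieRing 𝔫] [LieAlgebra ℚ 𝔫] [FiniteDimensional ℚ 𝔫]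
    (f : 𝔫 ≃ₗ⁅ℚ⁆ 𝔫) (hf : ∀ μ : L, Module.End.HasEigenvalue
      (LinearMap.baseChange L f.toLieHom.toLinearMap) μ → ¬ IsIntegral ℤ μ) :
    HasVerySpecialGrading ℂ (ℂ ⊗[ℚ] 𝔫) := by
  let ι : L →ₐ[ℚ] ℂ := IsAlgClosed.lift
  have key : ∀ a : ℂ, Module.End.HasEigenvalue
      (LinearMap.baseChange ℂ f.toLieHom.toLinearMap) a →
      ∃ μ : L, ι μ = a ∧ ¬ IsIntegral ℤ μ := by
    intro a ha
    rw [Module.End.hasEigenvalue_iff_isRoot_charpoly, LinearMap.charpoly_baseChange,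
      ← ι.comp_algebraMap, ← Polynomial.map_map] at ha
    obtain ⟨μ, rfl⟩ := (IsAlgClosed.splits _).mem_range_of_isRoot
      ((LinearMap.charpoly_monic _).map _).ne_zero ha
    refine ⟨μ, rfl, hf μ ?_⟩
    rw [Module.End.hasEigenvalue_iff_isRoot_charpoly, LinearMap.charpoly_baseChange]
    exact (Polynomial.isRoot_map_iff ι.injective).mp ha
  refine hasVerySpecialGrading_of_forall_not_isOfFinOrder
    (LinearMap.baseChange_lie_of_forall_lie fun x y ↦ f.map_lie x y) ?_ ?_
  · intro h
    obtain ⟨μ, hμ, hint⟩ := key _ h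
    rw [map_eq_zero] at hμ
    exact hint (hμ ▸ isIntegral_zero)
  · intro a ha hfin
    obtain ⟨μ, rfl, hint⟩ := key _ ha
    obtain ⟨n, hn, h1⟩ := isOfFinOrder_iff_pow_eq_one.mp hfin
    have h2 : μ ^ n = 1 := ι.injective (by rw [map_pow, map_one]; exact h1)
    exact hint (IsIntegral.of_pow hn (h2 ▸ isIntegral_one))

open Module in
theorem exists_derivation_of_hasVerySpecialGrading {K 𝔪 : Type*} [Field K] [CharZero K]
    [LieRing 𝔪] [LieAlgebra K 𝔪] [FiniteDimensional K 𝔪] (h : HasVerySpecialGrading K 𝔪) :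
    ∃ D : End K 𝔪, (∀ x y : 𝔪, D ⁅x, y⁆ = ⁅D x, y⁆ + ⁅x, D y⁆) ∧ LinearMap.det D ≠ 0 := by
  classical
  obtain ⟨p, ⟨hint, hlie⟩, h0⟩ := h
  let e := LinearEquiv.ofBijective (DirectSum.coeLinearMap p) hint
  let D : End K 𝔪 := DirectSum.toModule K ℤ 𝔪 (fun k ↦ (k : K) • (p k).subtype) ∘ₗ
    e.symm.toLinearMap
  have hD : ∀ k, ∀ x ∈ p k, D x = (k : K) • x := by
    intro k x hx
    have : e.symm x = DirectSum.lof K ℤ (fun k ↦ p k) k ⟨x, hx⟩ := by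
      rw [LinearEquiv.symm_apply_eq]
      exact (DirectSum.coeLinearMap_lof p k ⟨x, hx⟩).symm
    simp only [D, LinearMap.comp_apply, LinearEquiv.coe_coe]
    rw [this, DirectSum.toModule_lof]
    rfl
  have htop : ⨆ k, p k = ⊤ := hint.submodule_iSup_eq_top
  refine ⟨D, ?_, ?_⟩
  · let B : 𝔪 →ₗ[K] 𝔪 →ₗ[K] 𝔪 := (LieAlgebra.ad K 𝔪 : 𝔪 →ₗ[K] End K 𝔪)
    have := eq_of_forall_mem_iSup_eq_top htop (B := B.compr₂ D) (B' := B.comp D + B.compl₂ D) <| by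
      intro i j x hx y hy
      change D ⁅x, y⁆ = ⁅D x, y⁆ + ⁅x, D y⁆
      rw [hD i x hx, hD j y hy, hD _ _ (hlie i j x hx y hy), smul_lie, lie_smul, Int.cast_add,
        add_smul]
    exact fun x y ↦ LinearMap.congr_fun₂ this x y
  · rw [← isUnit_iff_ne_zero, ← LinearMap.isUnit_iff_isUnit_det, LinearMap.isUnit_iff_range_eq_top,
      eq_top_iff, ← htop]
    refine iSup_le fun k x hx ↦ ?_
    rcases eq_or_ne k 0 with rfl | hk
    · rw [h0, Submodule.mem_bot] at hx
      exact hx ▸ zero_mem _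
    · refine ⟨(k : K)⁻¹ • x, ?_⟩
      rw [map_smul, hD k x hx, smul_smul, inv_mul_cancel₀ (Int.cast_ne_zero.mpr hk), one_smul]

open MvPolynomial in
/-- The determinant of a matrix over an extension of an infinite field survives under a suitable
linear functional applied entrywise. -/
theorem exists_dual_det_map_ne_zero {k A n : Type*} [Field k] [Infinite k] [CommRing A]
    [Algebra k A] [Fintype n] [DecidableEq n] (M : Matrix n n A) (hM : M.det ≠ 0) :
    ∃ φ : A →ₗ[k] k, (M.map φ).det ≠ 0 := by
  let b := Module.Basis.ofVectorSpace k A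
  let ψ : A →ₗ[k] MvPolynomial _ k := b.constr k MvPolynomial.X
  have hψ : ∀ a, aeval b (ψ a) = a := by
    have : (aeval b).toLinearMap ∘ₗ ψ = LinearMap.id := b.ext fun i ↦ by
      simp [ψ, Module.Basis.constr_basis]
    exact fun a ↦ LinearMap.congr_fun this a
  have hne : (M.map ψ).det ≠ 0 := by
    intro h
    apply hM
    have h2 := congrArg (aeval b) h
    rw [AlgHom.map_det, map_zero] at h2
    rw [← h2]
    congr 1
    ext i j
    exact (hψ _).symm
  obtain ⟨t, ht⟩ : ∃ t, eval t (M.map ψ).det ≠ 0 := by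
    by_contra! h
    exact hne (MvPolynomial.funext fun t ↦ by rw [h t, map_zero])
  refine ⟨(aeval t).toLinearMap ∘ₗ ψ, ?_⟩
  rw [RingHom.map_det] at ht
  exact ht

open Module in
theorem exists_derivation_of_baseChange {k A L : Type*} [Field k] [Infinite k] [Field A]
    [Algebra k A] [LieRing L] [LieAlgebra k L] [FiniteDimensional k L] {D : End A (A ⊗[k] L)}
    (hD : ∀ x y : A ⊗[k] L, D ⁅x, y⁆ = ⁅D x, y⁆ + ⁅x, D y⁆) (hdet : LinearMap.det D ≠ 0) :
    ∃ d : End k L, (∀ x y : L, d ⁅x, y⁆ = ⁅d x, y⁆ + ⁅x, d y⁆) ∧ LinearMap.det d ≠ 0 := by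
  classical
  let e := Module.finBasis k L
  let E := e.baseChange A
  rw [← LinearMap.det_toMatrix E] at hdet
  obtain ⟨φ, hφ⟩ := exists_dual_det_map_ne_zero (k := k) _ hdet
  let π : A ⊗[k] L →ₗ[k] L := (TensorProduct.lid k L).toLinearMap ∘ₗ φ.rTensor L
  have hπ : ∀ (a : A) (x : L), π (a ⊗ₜ x) = φ a • x := fun a x ↦ by simp [π]
  have hπl : ∀ (z : A ⊗[k] L) (y : L), π ⁅z, (1 : A) ⊗ₜ[k] y⁆ = ⁅π z, y⁆ := by
    intro z y
    induction z with
    | zero => simp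
    | add z z' h h' => rw [add_lie, map_add, h, h', map_add, add_lie]
    | tmul a x => simp [hπ]
  have hπr : ∀ (z : A ⊗[k] L) (y : L), π ⁅(1 : A) ⊗ₜ[k] y, z⁆ = ⁅y, π z⁆ := by
    intro z y
    rw [← lie_skew, map_neg, hπl, lie_skew]
  have hrepr : ∀ z i, e.repr (π z) i = φ (E.repr z i) := by
    intro z i
    induction z with
    | zero => simp
    | add z z' h h' => simp [h, h']
    | tmul a x =>
      simp [hπ, E, mul_comm, smul_eq_mul]
  let d : End k L := π ∘ₗ D.restrictScalars k ∘ₗ TensorProduct.mk k A L 1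
  have hd : ∀ x, d x = π (D (1 ⊗ₜ x)) := fun _ ↦ rfl
  refine ⟨d, fun x y ↦ ?_, ?_⟩
  · have : (1 : A) ⊗ₜ[k] ⁅x, y⁆ = ⁅(1 : A) ⊗ₜ[k] x, (1 : A) ⊗ₜ[k] y⁆ := by simp
    rw [hd, hd, hd, this, hD, map_add, hπl, hπr]
  · rw [← LinearMap.det_toMatrix e]
    convert hφ using 2
    ext i j
    rw [LinearMap.toMatrix_apply, Matrix.map_apply, LinearMap.toMatrix_apply, hd, hrepr]
    simp [E]

open Polynomial in
/-- Galois-equivariant interpolation data are interpolated by a polynomial over the base field. -/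
theorem exists_polynomial_pow_dvd_map_sub_C {k K : Type*} [Field k] [CharZero k] [Field K]
    [Algebra k K] [FiniteDimensional k K] [IsGalois k K] (E : Finset K)
    (hE : ∀ σ : Gal(K/k), ∀ a ∈ E, σ a ∈ E) (c : K → K)
    (hc : ∀ σ : Gal(K/k), ∀ a ∈ E, c (σ a) = σ (c a)) (N : ℕ) :
    ∃ R : k[X], ∀ a ∈ E, (X - C a) ^ N ∣ R.map (algebraMap k K) - C (c a) := by
  classical
  obtain ⟨P, hP⟩ := exists_polynomial_pow_dvd_sub_C E c N
  let n : k := Fintype.card Gal(K/k)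
  have hn : n ≠ 0 := Nat.cast_ne_zero.mpr Fintype.card_ne_zero
  let Q : K[X] := C (algebraMap k K n⁻¹) * ∑ σ : Gal(K/k), P.map (σ : K →+* K)
  have hQ : Q ∈ Polynomial.lifts (algebraMap k K) := by
    rw [Polynomial.lifts_iff_coeff_lifts]
    intro i
    rw [IsGalois.mem_range_algebraMap_iff_fixed]
    intro τ
    simp only [Q, coeff_C_mul, finsetSum_coeff, coeff_map, map_mul, AlgEquiv.commutes, map_sum]
    congr 1
    exact Fintype.sum_equiv (Equiv.mulLeft τ) _ _ fun σ ↦ rfl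
  obtain ⟨R, hR⟩ := (Polynomial.mem_lifts _).mp hQ
  refine ⟨R, fun a ha ↦ ?_⟩
  have : Q - C (c a) =
      C (algebraMap k K n⁻¹) * ∑ σ : Gal(K/k), (P.map (σ : K →+* K) - C (c a)) := by
    have h1 : (Fintype.card Gal(K/k) : K[X]) = C (algebraMap k K n) := by simp [n]
    have h2 : C (algebraMap k K n⁻¹) * C (algebraMap k K n) = 1 := by
      rw [← C_mul, ← map_mul, inv_mul_cancel₀ hn, map_one, C_1]
    rw [Finset.sum_sub_distrib, mul_sub, Finset.sum_const, Finset.card_univ, nsmul_eq_mul, h1,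
      ← mul_assoc, h2, one_mul]
  rw [hR, this]
  refine Dvd.dvd.mul_left (Finset.dvd_sum fun σ _ ↦ ?_) _
  have h := Polynomial.map_dvd (σ : K →+* K) (hP _ (hE σ⁻¹ a ha))
  have hσ : σ (σ⁻¹ a) = a := by rw [← AlgEquiv.mul_apply, mul_inv_cancel, AlgEquiv.one_apply]
  have hσc : σ (c (σ⁻¹ a)) = c a := by rw [← hc σ _ (hE σ⁻¹ a ha), hσ]
  rw [Polynomial.map_pow, Polynomial.map_sub, Polynomial.map_sub, map_X, map_C, map_C] at h
  simpa only [RingHom.coe_coe, hσ, hσc] using h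

open Module Polynomial in
theorem exists_aut_of_derivation {𝔫 : Type*} [LieRing 𝔫] [LieAlgebra ℚ 𝔫]
    [FiniteDimensional ℚ 𝔫] (K L : Type*) [Field K] [NumberField K] [IsGalois ℚ K] [Field L]
    [CharZero L] [IsAlgClosed L] [Algebra K L] {d : End ℚ 𝔫}
    (hd : ∀ x y : 𝔫, d ⁅x, y⁆ = ⁅d x, y⁆ + ⁅x, d y⁆) (hdet : LinearMap.det d ≠ 0)
    (hsplit : (d.charpoly.map (algebraMap ℚ K)).Splits) :
    ∃ f : 𝔫 ≃ₗ⁅ℚ⁆ 𝔫, ∀ μ : L, Module.End.HasEigenvalue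
      (LinearMap.baseChange L f.toLieHom.toLinearMap) μ → ¬ IsIntegral ℤ μ := by
  classical
  let E : Finset K := (d.charpoly.aroots K).toFinset
  have hE : ∀ a, a ∈ E ↔ aeval a d.charpoly = 0 := fun a ↦ by
    rw [Multiset.mem_toFinset, mem_aroots, and_iff_right d.charpoly_monic.ne_zero]
  have hE0 : ∀ a ∈ E, a ≠ 0 := by
    rintro _ ha rfl
    rw [hE, ← map_zero (algebraMap ℚ K), aeval_algebraMap_apply, map_zero, map_eq_zero,
      coe_aeval_eq_eval, ← coeff_zero_eq_eval_zero] at ha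
    exact hdet (by rw [LinearMap.det_eq_sign_charpoly_coeff, ha, mul_zero])
  have hEσ : ∀ σ : Gal(K/ℚ), ∀ a ∈ E, σ a ∈ E := fun σ a ha ↦ by
    rw [hE] at ha ⊢
    rw [aeval_algHom_apply, ha, map_zero]
  obtain ⟨c, hadd, hgal, hint⟩ := exists_equivariant_exponential E hE0
  obtain ⟨R, hR⟩ := exists_polynomial_pow_dvd_map_sub_C E hEσ c hgal (finrank L (L ⊗[ℚ] 𝔫))
  let j := algebraMap K L
  have hj : Function.Injective j := j.injective
  let dL : End L (L ⊗[ℚ] 𝔫) := d.baseChange L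
  have hdL : ∀ x y, dL ⁅x, y⁆ = ⁅dL x, y⁆ + ⁅x, dL y⁆ :=
    LinearMap.baseChange_lie_of_forall_leibniz hd
  have hev : ∀ α, dL.HasEigenvalue α → ∃ a ∈ E, j a = α := by
    intro α hα
    rw [Module.End.hasEigenvalue_iff_isRoot_charpoly, LinearMap.charpoly_baseChange,
      IsScalarTower.algebraMap_eq ℚ K L, ← Polynomial.map_map] at hα
    obtain ⟨a, rfl⟩ := hsplit.mem_range_of_isRoot
      ((LinearMap.charpoly_monic _).map _).ne_zero hα
    refine ⟨a, ?_, rfl⟩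
    rw [hE, ← eval_map_algebraMap]
    exact (Polynomial.isRoot_map_iff hj).mp hα
  let cL : L → L := fun α ↦ j (c (Function.invFun j α))
  have hcL : ∀ a, cL (j a) = j (c a) := fun a ↦ by
    simp only [cL, Function.leftInverse_invFun hj a]
  let S : End ℚ 𝔫 := aeval d R
  let SL : End L (L ⊗[ℚ] 𝔫) := S.baseChange L
  have hSL : SL = aeval dL ((R.map (algebraMap ℚ K)).map j) := by
    rw [Polynomial.map_map, ← IsScalarTower.algebraMap_eq ℚ K L, aeval_map_algebraMap]
    exact (aeval_algHom_apply (End.baseChangeHom ℚ L 𝔫) d R).symm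
  have htop := End.iSup_maxGenEigenspace_eq_top dL
  have hS : ∀ α, ∀ x ∈ dL.maxGenEigenspace α, SL x = cL α • x := by
    intro α x hx
    by_cases hα : dL.HasEigenvalue α
    · obtain ⟨a, ha, rfl⟩ := hev α hα
      rw [hSL, hcL]
      refine aeval_apply_of_mem_maxGenEigenspace ?_ hx
      simpa using Polynomial.map_dvd j (hR a ha)
    · rw [eq_zero_of_mem_maxGenEigenspace hα hx, map_zero, smul_zero]
  have hSLlie : ∀ x y, SL ⁅x, y⁆ = ⁅SL x, SL y⁆ := by
    let B : L ⊗[ℚ] 𝔫 →ₗ[L] L ⊗[ℚ] 𝔫 →ₗ[L] L ⊗[ℚ] 𝔫 :=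
      (LieAlgebra.ad L (L ⊗[ℚ] 𝔫) : L ⊗[ℚ] 𝔫 →ₗ[L] End L (L ⊗[ℚ] 𝔫))
    have := eq_of_forall_mem_iSup_eq_top htop (B := B.compr₂ SL) (B' := B.compl₁₂ SL SL) <| by
      intro α β x hx y hy
      change SL ⁅x, y⁆ = ⁅SL x, SL y⁆
      by_cases hα : dL.HasEigenvalue α
      swap
      · simp [eq_zero_of_mem_maxGenEigenspace hα hx]
      by_cases hβ : dL.HasEigenvalue β
      swap
      · simp [eq_zero_of_mem_maxGenEigenspace hβ hy]
      rw [hS α x hx, hS β y hy, hS _ _ (lie_mem_maxGenEigenspace_add hdL hx hy)]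
      obtain ⟨a, ha, rfl⟩ := hev α hα
      obtain ⟨b, hb, rfl⟩ := hev β hβ
      rw [← map_add, hcL, hcL, hcL, hadd a ha b hb, map_mul, smul_lie, lie_smul, smul_smul]
    exact fun x y ↦ LinearMap.congr_fun₂ this x y
  have hnotint : ∀ μ : L, SL.HasEigenvalue μ → ¬ IsIntegral ℤ μ := by
    intro μ hμ
    obtain ⟨α, hα, rfl⟩ := exists_eq_of_hasEigenvalue htop hS hμ
    obtain ⟨a, ha, rfl⟩ := hev α hα
    rw [hcL, isIntegral_algebraMap_iff hj]
    exact hint a ha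
  have hmk : Function.Injective (TensorProduct.mk ℚ L 𝔫 1) :=
    Module.FaithfullyFlat.tensorProduct_mk_injective 𝔫
  have hSlie : ∀ x y : 𝔫, S ⁅x, y⁆ = ⁅S x, S y⁆ := by
    intro x y
    apply hmk
    simpa [SL] using hSLlie (1 ⊗ₜ x) (1 ⊗ₜ y)
  have hinj : Function.Injective S := by
    rw [injective_iff_map_eq_zero]
    intro x hx
    by_contra hne
    refine hnotint 0 (End.hasEigenvalue_of_hasEigenvector (x := (1 : L) ⊗ₜ[ℚ] x) ⟨?_, ?_⟩)
      isIntegral_zero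
    · rw [End.mem_eigenspace_iff]
      simp [SL, hx]
    · exact fun h ↦ hne (hmk (by simpa using h))
  let e := LinearEquiv.ofInjectiveEndo S hinj
  let f : 𝔫 ≃ₗ⁅ℚ⁆ 𝔫 := { e with map_lie' := fun {x y} ↦ hSlie x y }
  exact ⟨f, hnotint⟩

theorem isAlgebraic_rat_algebraicClosure : Algebra.IsAlgebraic ℚ (AlgebraicClosure ℚ) :=
  AlgebraicClosure.isAlgebraic ℚ

open Module in
theorem exists_aut_of_hasVerySpecialGrading {𝔫 : Type*} [LieRing 𝔫] [LieAlgebra ℚ 𝔫]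
    [FiniteDimensional ℚ 𝔫] (h : HasVerySpecialGrading ℂ (ℂ ⊗[ℚ] 𝔫))
    (L : Type*) [Field L] [CharZero L] [IsAlgClosed L] :
    ∃ f : 𝔫 ≃ₗ⁅ℚ⁆ 𝔫, ∀ μ : L, Module.End.HasEigenvalue
      (LinearMap.baseChange L f.toLieHom.toLinearMap) μ → ¬ IsIntegral ℤ μ := by
  obtain ⟨D, hD, hdet⟩ := exists_derivation_of_hasVerySpecialGrading h
  obtain ⟨d, hd, hddet⟩ := exists_derivation_of_baseChange hD hdet
  let K := IntermediateField.adjoin ℚ (d.charpoly.rootSet L)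
  have hK : d.charpoly.IsSplittingField ℚ K :=
    IntermediateField.adjoin_rootSet_isSplittingField (IsAlgClosed.splits _)
  have : FiniteDimensional ℚ K := Polynomial.IsSplittingField.finiteDimensional K d.charpoly
  have : Normal ℚ K := Normal.of_isSplittingField d.charpoly
  have : NumberField K := {}
  have : IsGalois ℚ K := {}
  exact exists_aut_of_derivation K L hd hddet hK.splits

/-- A finite-dimensional Lie algebra `𝔫` over `ℚ` is such that `ℂ ⊗ 𝔫`
admits a very special grading iff there is a Lie algebra automorphism `f` of `𝔫` none of
whose eigenvalues (in `ℚ̄`) is an algebraic integer. -/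
theorem hasVerySpecialGrading_iff_exists_aut_no_integral_eigenvalue
    {𝔫 : Type*} [LieRing 𝔫] [LieAlgebra ℚ 𝔫] [FiniteDimensional ℚ 𝔫] :
    HasVerySpecialGrading ℂ (ℂ ⊗[ℚ] 𝔫) ↔
      ∃ f : 𝔫 ≃ₗ⁅ℚ⁆ 𝔫, ∀ μ : AlgebraicClosure ℚ,
        Module.End.HasEigenvalue
          (LinearMap.baseChange (AlgebraicClosure ℚ) f.toLieHom.toLinearMap) μ →
        ¬ IsIntegral ℤ μ := by
  have := isAlgebraic_rat_algebraicClosure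
  exact ⟨fun h ↦ exists_aut_of_hasVerySpecialGrading h _,
    fun ⟨f, hf⟩ ↦ hasVerySpecialGrading_of_aut f hf⟩
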